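/- arXiv:2004.02737 — 3 statements merged into one kernel-verified Lean document; each statement's English description precedes it below -/
import Mathlib

section
/- Let K = ℚ(q, q̄, z) and V = K^n. Set p = qⁿ·q̄, D = diag(q², q⁴, …, q^{2n}) ∈ End(V), D₁ = D⊗1 ∈ End(V⊗V), and R̃⁺(x) = R₂₁(1/(x·q̄²)) where R₂₁(w) = P·R(w)·P. Then the crossing-unitarity identity holds: (D₁⁻¹ · R̃⁺₁₂(z) · D₁)^{†₁} · (R₁₂(z·p²))^{†₁} = Id_{V⊗V}, where †₁ denotes partial transposition in the first tensor factor, i.e. (E_{ij}⊗E_{kl})^{†₁} = E_{ji}⊗E_{kl}. -/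
/-!
STATEMENT 3: The crossing-unitarity identity
`(D₁⁻¹ · R̃⁺₁₂(z) · D₁)^{†₁} · (R₁₂(z·p²))^{†₁} = Id_{V⊗V}`,
where K = ℚ(q, q̄, z), V = K^n, p = qⁿ·q̄, D = diag(q²,…,q^{2n}),
D₁ = D⊗1, R̃⁺(x) = R₂₁(1/(x·q̄²)), and †₁ is partial transposition in the
first tensor factor.
-/

open MvPolynomial

noncomputable section

/-- The field ℚ(q, q̄, z). -/
abbrev K3 : Type := FractionRing (MvPolynomial (Fin 3) ℚ)

noncomputable def q3 : K3 := algebraMap (MvPolynomial (Fin 3) ℚ) K3 (X 0)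
noncomputable def qbar3 : K3 := algebraMap (MvPolynomial (Fin 3) ℚ) K3 (X 1)
noncomputable def z3 : K3 := algebraMap (MvPolynomial (Fin 3) ℚ) K3 (X 2)

/-- The trigonometric R-matrix on V ⊗ V. -/
def Rmat (n : ℕ) {K : Type*} [Field K] (q x : K) :
    Matrix (Fin n × Fin n) (Fin n × Fin n) K :=
  Matrix.of fun p r =>
    (if p = r then (if p.1 = p.2 then (q - x * q⁻¹) / (1 - x) else 1) else 0) +
    (if p.1 ≠ p.2 ∧ r.1 = p.2 ∧ r.2 = p.1 then
      (q - q⁻¹) * (if p.1 < p.2 then x else 1) / (1 - x) else 0)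

/-- The permutation operator `P = Σ_{i,j} E_ij ⊗ E_ji` on V ⊗ V. -/
def Pmat (n : ℕ) (K : Type*) [Field K] :
    Matrix (Fin n × Fin n) (Fin n × Fin n) K :=
  Matrix.of fun p r => if r.1 = p.2 ∧ r.2 = p.1 then 1 else 0

/-- `R̃⁺(x) = R₂₁(1/(x·q̄²)) = P · R(1/(x·q̄²)) · P`. -/
def Rtilde (n : ℕ) {K : Type*} [Field K] (q qbar x : K) :
    Matrix (Fin n × Fin n) (Fin n × Fin n) K :=
  Pmat n K * Rmat n q (x * qbar ^ 2)⁻¹ * Pmat n K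

/-- `D₁ = D ⊗ 1` where `D = diag(q², q⁴, …, q^{2n})`. -/
def D1 (n : ℕ) {K : Type*} [Field K] (q : K) :
    Matrix (Fin n × Fin n) (Fin n × Fin n) K :=
  Matrix.diagonal fun p => q ^ (2 * ((p.1 : ℕ) + 1))

/-- Partial transposition in the first tensor factor:
`(E_ij ⊗ E_kl)^{†₁} = E_ji ⊗ E_kl`. -/
def ptrans1 (n : ℕ) {K : Type*} [Field K]
    (M : Matrix (Fin n × Fin n) (Fin n × Fin n) K) :
    Matrix (Fin n × Fin n) (Fin n × Fin n) K :=
  Matrix.of fun p r => M (r.1, p.2) (p.1, r.2)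

section CrossingUnitarity

variable {n : ℕ} {K : Type*} [Field K]

/-- The operator on `V ⊗ V` acting as `S` on the span of the `eᵢ ⊗ eᵢ` and as the identity on the
span of the `eᵢ ⊗ eⱼ` with `i ≠ j`. -/
def diagonalBlock (S : Matrix (Fin n) (Fin n) K) :
    Matrix (Fin n × Fin n) (Fin n × Fin n) K :=
  Matrix.of fun p r =>
    if p.1 = p.2 then (if r.1 = r.2 then S p.1 r.1 else 0) else (if p = r then 1 else 0)

lemma diagonalBlock_mul (S T : Matrix (Fin n) (Fin n) K) :
    diagonalBlock S * diagonalBlock T = diagonalBlock (S * T) := by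
  ext ⟨a, b⟩ ⟨c, d⟩
  rw [Matrix.mul_apply]
  by_cases h : a = b
  · subst h
    rw [Fintype.sum_prod_type]
    have key : ∀ e : Fin n, ∑ f, diagonalBlock S (a, a) (e, f) * diagonalBlock T (e, f) (c, d)
        = if c = d then S a e * T e c else 0 := by
      intro e
      rw [Finset.sum_eq_single e]
      · simp [diagonalBlock]
      · intro f _ hf
        simp [diagonalBlock, hf.symm]
      · simp
    simp only [key]
    by_cases hc : c = d <;> simp [diagonalBlock, hc, Matrix.mul_apply]
  · rw [Finset.sum_eq_single (a, b)]
    · simp [diagonalBlock, h]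
    · intro x _ hx
      simp [diagonalBlock, h, hx.symm]
    · simp

lemma diagonalBlock_one : diagonalBlock (1 : Matrix (Fin n) (Fin n) K) = 1 := by
  ext ⟨a, b⟩ ⟨c, d⟩
  simp only [diagonalBlock, Matrix.of_apply, Matrix.one_apply, Prod.mk.injEq]
  grind

lemma Pmat_conj_apply (M : Matrix (Fin n × Fin n) (Fin n × Fin n) K) (p r : Fin n × Fin n) :
    (Pmat n K * M * Pmat n K) p r = M p.swap r.swap := by
  rw [Matrix.mul_apply, Finset.sum_eq_single r.swap]
  · rw [Matrix.mul_apply, Finset.sum_eq_single p.swap]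
    · simp [Pmat]
    · rintro ⟨x, y⟩ _ h
      have : ¬ (x = p.2 ∧ y = p.1) := fun hxy => h (Prod.ext hxy.1 hxy.2)
      simp [Pmat, this]
    · simp
  · rintro ⟨x, y⟩ _ h
    have : ¬ (r.1 = y ∧ r.2 = x) := fun hxy => h (Prod.ext hxy.2.symm hxy.1.symm)
    simp [Pmat, this]
  · simp

lemma D1_inv {q : K} (hq : q ≠ 0) :
    (D1 n q)⁻¹ = Matrix.diagonal fun p => (q ^ (2 * ((p.1 : ℕ) + 1)))⁻¹ := by
  apply Matrix.inv_eq_left_inv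
  rw [D1, Matrix.diagonal_mul_diagonal, ← Matrix.diagonal_one]
  congr 1
  ext p
  exact inv_mul_cancel₀ (pow_ne_zero _ hq)

/-- The action of the partial transpose of `R(u)` on the span of the `eᵢ ⊗ eᵢ`. -/
def transposedBlock (n : ℕ) (q u : K) : Matrix (Fin n) (Fin n) K :=
  Matrix.of fun a c =>
    ((q - q⁻¹) * (if (a : ℕ) < c + 1 then 1 else u) + if a = c then (1 - u) / q else 0) / (1 - u)

/-- The action of the partial transpose of `D₁⁻¹ R₂₁(y⁻¹) D₁` on the span of the `eᵢ ⊗ eᵢ`. -/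
def conjTransposedBlock (n : ℕ) (q y : K) : Matrix (Fin n) (Fin n) K :=
  Matrix.of fun a c =>
    ((q - q⁻¹) * (q ^ (2 * (a : ℕ)) * (q ^ (2 * (c : ℕ)))⁻¹) * (if (c : ℕ) < a + 1 then y else 1) +
      if a = c then (y - 1) / q else 0) / (y - 1)

lemma ptrans1_Rmat {q u : K} (hq : q ≠ 0) (hu : 1 - u ≠ 0) :
    ptrans1 n (Rmat n q u) = diagonalBlock (transposedBlock n q u) := by
  ext ⟨a, b⟩ ⟨c, d⟩
  simp only [ptrans1, Rmat, diagonalBlock, transposedBlock, Matrix.of_apply, Prod.mk.injEq]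
  by_cases h : a = b
  · subst h
    by_cases hc : c = d
    · subst hc
      rcases lt_trichotomy a c with h | rfl | h
      · have h' : (a : ℕ) < c + 1 := by have : (a : ℕ) < c := h; omega
        simp [h.ne, h.ne', h', h.not_gt]
      · simp
        field_simp
        ring
      · have h' : ¬ (a : ℕ) < c + 1 := by have : (c : ℕ) < a := h; omega
        simp [h.ne, h.ne', h', h]
    · grind
  · grind

lemma ptrans1_conj_Rtilde {q qbar z : K} (hq : q ≠ 0) (hy : z * qbar ^ 2 ≠ 0)
    (hy1 : z * qbar ^ 2 - 1 ≠ 0) :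
    ptrans1 n ((D1 n q)⁻¹ * Rtilde n q qbar z * D1 n q) =
      diagonalBlock (conjTransposedBlock n q (z * qbar ^ 2)) := by
  unfold Rtilde
  generalize z * qbar ^ 2 = y at *
  have hw : 1 - y⁻¹ ≠ 0 := by
    intro h
    apply hy1
    field_simp at h
    simpa using h
  ext ⟨a, b⟩ ⟨c, d⟩
  rw [D1_inv hq, ptrans1, D1, Matrix.of_apply, Matrix.mul_diagonal, Matrix.diagonal_mul,
    Pmat_conj_apply]
  simp only [Rmat, diagonalBlock, conjTransposedBlock, Matrix.of_apply, Prod.mk.injEq,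
    Prod.swap_prod_mk]
  by_cases h : a = b
  · subst h
    by_cases hc : c = d
    · subst hc
      rcases lt_trichotomy a c with h | rfl | h
      · have h' : ¬ (c : ℕ) < a + 1 := by have : (a : ℕ) < c := h; omega
        simp [h.ne, h.ne', h', h]
        field_simp
        ring
      · simp
        field_simp
        ring
      · have h' : (c : ℕ) < a + 1 := by have : (c : ℕ) < a := h; omega
        simp [h.ne, h.ne', h', h.not_gt]
        field_simp
        ring
    · grind
  · by_cases hac : a = c <;> by_cases hbd : b = d
    · subst hac hbd
      have := pow_ne_zero (2 * ((a : ℕ) + 1)) hq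
      simp [h, Ne.symm h]
      field_simp
    all_goals grind

lemma sum_range_geom_inv {q : K} (hq : q ≠ 0) (m : ℕ) :
    ∑ b ∈ Finset.range m, (q - q⁻¹) * (q ^ (2 * b))⁻¹ = q * (1 - (q ^ (2 * m))⁻¹) := by
  induction m with
  | zero => simp
  | succ m ih =>
    rw [Finset.sum_range_succ, ih]
    field_simp
    ring

lemma sum_range_geom_inv_ite {q : K} (hq : q ≠ 0) {m n : ℕ} (hmn : m ≤ n) :
    ∑ b ∈ Finset.range n, (q - q⁻¹) * (q ^ (2 * b))⁻¹ * (if b < m then 1 else 0) =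
      q * (1 - (q ^ (2 * m))⁻¹) := by
  rw [← sum_range_geom_inv hq m]
  simp only [mul_ite, mul_one, mul_zero]
  rw [← Finset.sum_filter]
  congr 1
  ext b
  simp only [Finset.mem_filter, Finset.mem_range]
  omega

lemma sum_range_geom_inv_two_steps {q y : K} (hq : q ≠ 0) {n a c : ℕ} (ha : a < n) (hc : c < n) :
    ∑ b ∈ Finset.range n, (q - q⁻¹) * (q ^ (2 * b))⁻¹ *
        ((if b < a + 1 then y else 1) * (if b < c + 1 then 1 else y * q ^ (2 * n))) =
      -q * ((1 - y * q ^ (2 * n)) * (q ^ (2 * (c + 1)))⁻¹ * (if c < a + 1 ∧ a ≠ c then y else 1) +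
        (y - 1) * (q ^ (2 * (a + 1)))⁻¹ * (if a < c + 1 then 1 else y * q ^ (2 * n))) := by
  have hn := sum_range_geom_inv hq n
  have hA := sum_range_geom_inv_ite hq (show a + 1 ≤ n from ha)
  have hC := sum_range_geom_inv_ite hq (show c + 1 ≤ n from hc)
  have hu : q ^ (2 * n) * (q ^ (2 * n))⁻¹ = 1 := mul_inv_cancel₀ (pow_ne_zero _ hq)
  generalize q ^ (2 * n) = Q at *
  by_cases hac : a < c + 1
  · have e : ∀ b : ℕ, (q - q⁻¹) * (q ^ (2 * b))⁻¹ *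
        ((if b < a + 1 then y else 1) * (if b < c + 1 then 1 else y * Q)) =
        y * Q * ((q - q⁻¹) * (q ^ (2 * b))⁻¹) +
        (1 - y * Q) * ((q - q⁻¹) * (q ^ (2 * b))⁻¹ * (if b < c + 1 then 1 else 0)) +
        (y - 1) * ((q - q⁻¹) * (q ^ (2 * b))⁻¹ * (if b < a + 1 then 1 else 0)) := by
      intro b
      by_cases h1 : b < a + 1
      · have h2 : b < c + 1 := by omega
        simp only [h1, h2, if_true]; ring
      · by_cases h2 : b < c + 1 <;> simp only [h1, h2, if_true, if_false] <;> ring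
    have hcond : ¬ (c < a + 1 ∧ a ≠ c) := by omega
    simp only [e, Finset.sum_add_distrib, ← Finset.mul_sum, hn, hA, hC, hac, hcond, if_true,
      if_false]
    linear_combination -q * y * hu
  · have e : ∀ b : ℕ, (q - q⁻¹) * (q ^ (2 * b))⁻¹ *
        ((if b < a + 1 then y else 1) * (if b < c + 1 then 1 else y * Q)) =
        y * Q * ((q - q⁻¹) * (q ^ (2 * b))⁻¹) +
        y * (1 - y * Q) * ((q - q⁻¹) * (q ^ (2 * b))⁻¹ * (if b < c + 1 then 1 else 0)) +
        y * Q * (y - 1) * ((q - q⁻¹) * (q ^ (2 * b))⁻¹ * (if b < a + 1 then 1 else 0)) := by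
      intro b
      by_cases h2 : b < c + 1
      · have h1 : b < a + 1 := by omega
        simp only [h1, h2, if_true]; ring
      · by_cases h1 : b < a + 1 <;> simp only [h1, h2, if_true, if_false] <;> ring
    have hcond : c < a + 1 ∧ a ≠ c := by omega
    simp only [e, Finset.sum_add_distrib, ← Finset.mul_sum, hn, hA, hC, hac, hcond, if_true,
      if_false, ne_eq, not_false_eq_true, and_self]
    linear_combination -q * y * hu

lemma conjTransposedBlock_mul_transposedBlock {q y : K} (hq : q ≠ 0) (hy : y - 1 ≠ 0)
    (hu : 1 - y * q ^ (2 * n) ≠ 0) :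
    conjTransposedBlock n q y * transposedBlock n q (y * q ^ (2 * n)) = 1 := by
  ext a c
  have key := sum_range_geom_inv_two_steps (y := y) hq a.2 c.2
  rw [← Fin.sum_univ_eq_sum_range (fun b => (q - q⁻¹) * (q ^ (2 * b))⁻¹ *
        ((if b < a + 1 then y else 1) * (if b < c + 1 then 1 else y * q ^ (2 * n))))] at key
  generalize y * q ^ (2 * n) = u at *
  have expand : ∀ b : Fin n, conjTransposedBlock n q y a b * transposedBlock n q u b c =
      ((q - q⁻¹) * q ^ (2 * (a : ℕ)) * ((q - q⁻¹) * (q ^ (2 * (b : ℕ)))⁻¹ *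
        ((if (b : ℕ) < a + 1 then y else 1) * (if (b : ℕ) < c + 1 then 1 else u))) +
      (if a = b then (y - 1) / q * ((q - q⁻¹) * (if (b : ℕ) < c + 1 then 1 else u) +
        if b = c then (1 - u) / q else 0) else 0) +
      (if b = c then (q - q⁻¹) * (q ^ (2 * (a : ℕ)) * (q ^ (2 * (b : ℕ)))⁻¹) *
        (if (b : ℕ) < a + 1 then y else 1) * ((1 - u) / q) else 0)) / ((y - 1) * (1 - u)) := by
    intro b
    simp only [conjTransposedBlock, transposedBlock, Matrix.of_apply]
    rw [div_mul_div_comm]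
    congr 1
    split_ifs <;> ring
  simp only [Matrix.mul_apply, expand, ← Finset.sum_div, Finset.sum_add_distrib, ← Finset.mul_sum,
    key, Finset.sum_ite_eq, Finset.sum_ite_eq', Finset.mem_univ, if_true, Matrix.one_apply]
  rw [div_eq_iff (mul_ne_zero hy hu)]
  by_cases h : a = c
  · subst h
    simp
    field_simp
    ring
  · have h' : (a : ℕ) ≠ c := fun e => h (Fin.ext e)
    simp only [h, h', ne_eq, not_false_eq_true, and_true, if_false]
    field_simp
    ring

end CrossingUnitarity

section FractionField

variable {σ R : Type*} (K : Type*) [CommRing R] [Field K]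
  [Algebra (MvPolynomial σ R) K] [IsFractionRing (MvPolynomial σ R) K]

lemma algebraMap_ne_zero_of_eval_ne_zero {f : MvPolynomial σ R} (x : σ → R) (hf : eval x f ≠ 0) :
    algebraMap (MvPolynomial σ R) K f ≠ 0 := by
  rw [Ne, IsFractionRing.to_map_eq_zero_iff]
  rintro rfl
  exact hf (map_zero _)

lemma algebraMap_X_ne_zero [Nontrivial R] (i : σ) : algebraMap (MvPolynomial σ R) K (X i) ≠ 0 :=
  algebraMap_ne_zero_of_eval_ne_zero K 1 (by simp)

lemma one_sub_algebraMap_X_mul_ne_zero [Nontrivial R] (i j k : σ) (m : ℕ) :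
    1 - algebraMap (MvPolynomial σ R) K (X i) * algebraMap (MvPolynomial σ R) K (X j) ^ 2 *
      algebraMap (MvPolynomial σ R) K (X k) ^ m ≠ 0 := by
  have h := algebraMap_ne_zero_of_eval_ne_zero K (f := 1 - X i * X j ^ 2 * X k ^ m) (0 : σ → R)
    (by simp)
  rwa [map_sub, map_mul, map_mul, map_pow, map_pow, map_one] at h

end FractionField

/-- Crossing unitarity:
`(D₁⁻¹ R̃⁺₁₂(z) D₁)^{†₁} · (R₁₂(z p²))^{†₁} = Id` with `p = qⁿ q̄`. -/
theorem crossing_unitarity (n : ℕ) (hn : 1 ≤ n) :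
    ptrans1 n ((D1 n q3)⁻¹ * Rtilde n q3 qbar3 z3 * D1 n q3) *
        ptrans1 n (Rmat n q3 (z3 * (q3 ^ n * qbar3) ^ 2))
      = (1 : Matrix (Fin n × Fin n) (Fin n × Fin n) K3) := by
  have hq : q3 ≠ 0 := algebraMap_X_ne_zero K3 0
  have hy : z3 * qbar3 ^ 2 ≠ 0 :=
    mul_ne_zero (algebraMap_X_ne_zero K3 2) (pow_ne_zero _ (algebraMap_X_ne_zero K3 1))
  have hu (m : ℕ) : 1 - z3 * qbar3 ^ 2 * q3 ^ m ≠ 0 :=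
    one_sub_algebraMap_X_mul_ne_zero K3 2 1 0 m
  have hy1 : z3 * qbar3 ^ 2 - 1 ≠ 0 := by
    rw [sub_ne_zero, ne_comm, ← sub_ne_zero]
    simpa only [pow_zero, mul_one] using hu 0
  have e : z3 * (q3 ^ n * qbar3) ^ 2 = z3 * qbar3 ^ 2 * q3 ^ (2 * n) := by ring
  rw [e, ptrans1_conj_Rtilde hq hy hy1, ptrans1_Rmat hq (hu _), diagonalBlock_mul,
    conjTransposedBlock_mul_transposedBlock hq hy1 (hu _), diagonalBlock_one]

end
end

section
/- Let K = ℚ(q, q̄, z), V = K^n, p = qⁿ·q̄, D = diag(q², q⁴, …, q^{2n}), and R̃⁺(x) = R₂₁(1/(x·q̄²)) where R₂₁(w) = P·R(w)·P. Let A = Σ_{1≤i,j≤n} E_{ij}⊗E_{ij} ∈ End(V⊗V). Then in End(V^{⊗4}), with tensor factors labeled 1,2,3,4: A₁₃ · (R(z·p²)ᵀ)₃₄ · (D₁⁻¹ · R̃⁺₁₂(z) · D₁) · A₂₄ = A₁₃ · A₂₄, where A₁₃ (resp. A₂₄) denotes A acting in factors 1 and 3 (resp. 2 and 4), (R(z·p²)ᵀ)₃₄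 is the full transpose of R(z·p²) acting in factors 3 and 4, and D₁⁻¹·R̃⁺₁₂(z)·D₁ acts in factors 1 and 2. -/
/-!
STATEMENT 4: In End(V^{⊗4}) with tensor factors labeled 1,2,3,4:
`A₁₃ · (R(z·p²)ᵀ)₃₄ · (D₁⁻¹·R̃⁺₁₂(z)·D₁) · A₂₄ = A₁₃ · A₂₄`,
where K = ℚ(q, q̄, z), V = K^n, p = qⁿ·q̄, D = diag(q²,…,q^{2n}),
R̃⁺(x) = R₂₁(1/(x·q̄²)), and A = Σ_{i,j} E_ij ⊗ E_ij.
-/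

open MvPolynomial

noncomputable section

/-- The field ℚ(q, q̄, z). -/
abbrev K4 : Type := FractionRing (MvPolynomial (Fin 3) ℚ)

noncomputable def q4 : K4 := algebraMap (MvPolynomial (Fin 3) ℚ) K4 (X 0)
noncomputable def qbar4 : K4 := algebraMap (MvPolynomial (Fin 3) ℚ) K4 (X 1)
noncomputable def z4 : K4 := algebraMap (MvPolynomial (Fin 3) ℚ) K4 (X 2)

/-- The operator `A = Σ_{1≤i,j≤n} E_ij ⊗ E_ij` on V ⊗ V. -/
def Amat (n : ℕ) (K : Type*) [Field K] :
    Matrix (Fin n × Fin n) (Fin n × Fin n) K :=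
  Matrix.of fun p r => if p.1 = p.2 ∧ r.1 = r.2 then 1 else 0

/-- Basis index set of V^{⊗4}. -/
abbrev I4 (n : ℕ) := Fin n × Fin n × Fin n × Fin n

/-- An operator on V⊗V acting in tensor factors 1 and 2 of V^{⊗4}. -/
def pl12 (n : ℕ) {K : Type*} [Field K]
    (Xm : Matrix (Fin n × Fin n) (Fin n × Fin n) K) : Matrix (I4 n) (I4 n) K :=
  Matrix.of fun p r => Xm (p.1, p.2.1) (r.1, r.2.1) *
    (if p.2.2 = r.2.2 then 1 else 0)

/-- An operator on V⊗V acting in tensor factors 1 and 3 of V^{⊗4}. -/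
def pl13 (n : ℕ) {K : Type*} [Field K]
    (Xm : Matrix (Fin n × Fin n) (Fin n × Fin n) K) : Matrix (I4 n) (I4 n) K :=
  Matrix.of fun p r => Xm (p.1, p.2.2.1) (r.1, r.2.2.1) *
    (if p.2.1 = r.2.1 ∧ p.2.2.2 = r.2.2.2 then 1 else 0)

/-- An operator on V⊗V acting in tensor factors 2 and 4 of V^{⊗4}. -/
def pl24 (n : ℕ) {K : Type*} [Field K]
    (Xm : Matrix (Fin n × Fin n) (Fin n × Fin n) K) : Matrix (I4 n) (I4 n) K :=
  Matrix.of fun p r => Xm (p.2.1, p.2.2.2) (r.2.1, r.2.2.2) *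
    (if p.1 = r.1 ∧ p.2.2.1 = r.2.2.1 then 1 else 0)

/-- An operator on V⊗V acting in tensor factors 3 and 4 of V^{⊗4}. -/
def pl34 (n : ℕ) {K : Type*} [Field K]
    (Xm : Matrix (Fin n × Fin n) (Fin n × Fin n) K) : Matrix (I4 n) (I4 n) K :=
  Matrix.of fun p r => Xm (p.2.2.1, p.2.2.2) (r.2.2.1, r.2.2.2) *
    (if p.1 = r.1 ∧ p.2.1 = r.2.1 then 1 else 0)

theorem Rmat_apply {n : ℕ} {K : Type*} [Field K] {q x : K} (hx : 1 - x ≠ 0) (a b c d : Fin n) :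
    Rmat n q x (a, b) (c, d) =
      (if a = c then if b = d then if a = b then q⁻¹ else 1 else 0 else 0) +
      (if c = b then if d = a then
        (q - q⁻¹) / (1 - x) * (if (a : ℕ) < b then x else 1) else 0 else 0) := by
  have key : (q - x * q⁻¹) / (1 - x) = q⁻¹ + (q - q⁻¹) / (1 - x) := by
    rw [eq_comm, ← sub_eq_zero]
    field_simp
    ring
  simp only [Rmat, Matrix.of_apply, Prod.mk.injEq, Fin.lt_def, mul_div_right_comm, ne_eq]
  by_cases hab : a = b
  · subst hab
    rw [key]
    grind
  · grind

theorem Rtilde_apply {n : ℕ} {K : Type*} [Field K] (q qbar x : K) (a b c d : Fin n) :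
    Rtilde n q qbar x (a, b) (c, d) = Rmat n q (x * qbar ^ 2)⁻¹ (b, a) (d, c) := by
  simp [Rtilde, Pmat, Matrix.mul_apply, Fintype.sum_prod_type, ite_and]

theorem D1_conj_apply {n : ℕ} {K : Type*} [Field K] {q : K} (hq : q ≠ 0)
    (X : Matrix (Fin n × Fin n) (Fin n × Fin n) K) (a b c d : Fin n) :
    ((D1 n q)⁻¹ * X * D1 n q) (a, b) (c, d) =
      (q ^ (2 * ((a : ℕ) + 1)))⁻¹ * X (a, b) (c, d) * q ^ (2 * ((c : ℕ) + 1)) := by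
  have hinv : (D1 n q)⁻¹ =
      Matrix.diagonal fun p : Fin n × Fin n => (q ^ (2 * ((p.1 : ℕ) + 1)))⁻¹ := by
    apply Matrix.inv_eq_right_inv
    simp [D1, hq]
  rw [hinv, D1, Matrix.mul_diagonal, Matrix.diagonal_mul]

theorem pl13_Amat_mul_apply {n : ℕ} {K : Type*} [Field K] (M : Matrix (I4 n) (I4 n) K)
    (a b c d : Fin n) (r : I4 n) :
    (pl13 n (Amat n K) * M) (a, b, c, d) r =
      if a = c then ∑ s, M (s, b, s, d) r else 0 := by
  simp [pl13, Amat, Matrix.mul_apply, Fintype.sum_prod_type, ite_and]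

theorem mul_pl24_Amat_apply {n : ℕ} {K : Type*} [Field K] (M : Matrix (I4 n) (I4 n) K)
    (p : I4 n) (a b c d : Fin n) :
    (M * pl24 n (Amat n K)) p (a, b, c, d) =
      if b = d then ∑ s, M p (a, s, c, s) else 0 := by
  simp [pl24, Amat, Matrix.mul_apply, Fintype.sum_prod_type, ite_and]

theorem pl34_mul_pl12_apply {n : ℕ} {K : Type*} [Field K]
    (X Y : Matrix (Fin n × Fin n) (Fin n × Fin n) K) (a b c d a' b' c' d' : Fin n) :
    (pl34 n X * pl12 n Y) (a, b, c, d) (a', b', c', d') =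
      X (c, d) (c', d') * Y (a, b) (a', b') := by
  simp [pl34, pl12, Matrix.mul_apply, Fintype.sum_prod_type, ite_and]

theorem sum_range_telescope_two_steps {K : Type*} [Field K] (u : ℕ → K) (c d : K) {l m N : ℕ}
    (hlm : l ≤ m) (hmN : m < N) :
    ∑ a ∈ Finset.range N,
        (u a - u (a + 1)) * ((if l < a then c else 1) * (if m < a then d else 1)) =
      u 0 - u (l + 1) + c * (u (l + 1) - u (m + 1)) + c * d * (u (m + 1) - u N) := by
  have gen : ∀ N, ∑ a ∈ Finset.range N,
        (u a - u (a + 1)) * ((if l < a then c else 1) * (if m < a then d else 1)) =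
      u 0 - u (min N (l + 1)) + c * (u (min N (l + 1)) - u (min N (m + 1))) +
        c * d * (u (min N (m + 1)) - u N) := by
    intro N
    induction N with
    | zero => simp
    | succ N ih =>
      rw [Finset.sum_range_succ, ih]
      by_cases h1 : l < N
      · by_cases h2 : m < N
        · rw [if_pos h1, if_pos h2, min_eq_right (by omega : l + 1 ≤ N),
            min_eq_right (by omega : m + 1 ≤ N), min_eq_right (by omega : l + 1 ≤ N + 1),
            min_eq_right (by omega : m + 1 ≤ N + 1)]
          ring
        · rw [if_pos h1, if_neg h2, min_eq_right (by omega : l + 1 ≤ N),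
            min_eq_left (by omega : N ≤ m + 1), min_eq_right (by omega : l + 1 ≤ N + 1),
            min_eq_left (by omega : N + 1 ≤ m + 1)]
          ring
      · rw [if_neg h1, if_neg (by omega : ¬ m < N), min_eq_left (by omega : N ≤ l + 1),
          min_eq_left (by omega : N ≤ m + 1), min_eq_left (by omega : N + 1 ≤ l + 1),
          min_eq_left (by omega : N + 1 ≤ m + 1)]
        ring
  rw [gen, min_eq_right (by omega), min_eq_right (by omega)]

theorem crossing_scalar_identity {K : Type*} [Field K] {n : ℕ} {q x w : K} (hq : q ≠ 0)
    (hx : 1 - x ≠ 0) (hw : 1 - w ≠ 0) (hxw : x * w = q ^ (2 * n)) (i k : Fin n) :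
    (if i = k then q⁻¹ * q⁻¹ else 0) +
      q⁻¹ * ((q ^ (2 * ((k : ℕ) + 1)))⁻¹ *
        ((q - q⁻¹) / (1 - w) * (if (i : ℕ) < k then w else 1)) * q ^ (2 * ((i : ℕ) + 1))) +
      (q - q⁻¹) / (1 - x) * (if (k : ℕ) < i then x else 1) * q⁻¹ +
      ∑ a : Fin n, (q - q⁻¹) / (1 - x) * (if (k : ℕ) < a then x else 1) *
        ((q ^ (2 * ((a : ℕ) + 1)))⁻¹ *
          ((q - q⁻¹) / (1 - w) * (if (i : ℕ) < a then w else 1)) * q ^ (2 * ((i : ℕ) + 1))) =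
      if i = k then 1 else 0 := by
  set u : ℕ → K := fun a => q * (q ^ (2 * a))⁻¹ with hu
  have hterm : ∀ a : ℕ, (q - q⁻¹) / (1 - x) * (if (k : ℕ) < a then x else 1) *
        ((q ^ (2 * (a + 1)))⁻¹ *
          ((q - q⁻¹) / (1 - w) * (if (i : ℕ) < a then w else 1)) * q ^ (2 * ((i : ℕ) + 1))) =
      (q - q⁻¹) / (1 - x) / (1 - w) * q ^ (2 * (i : ℕ)) * ((u a - u (a + 1)) *
        ((if (k : ℕ) < a then x else 1) * (if (i : ℕ) < a then w else 1))) := by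
    intro a
    have : u a - u (a + 1) = (q - q⁻¹) * (q ^ (2 * a))⁻¹ := by
      simp only [hu, mul_add, pow_add]
      field_simp
    rw [this]
    simp only [mul_add, pow_add]
    field_simp
  rw [Fin.sum_univ_eq_sum_range (fun a : ℕ =>
        (q - q⁻¹) / (1 - x) * (if (k : ℕ) < a then x else 1) *
        ((q ^ (2 * (a + 1)))⁻¹ *
          ((q - q⁻¹) / (1 - w) * (if (i : ℕ) < a then w else 1)) * q ^ (2 * ((i : ℕ) + 1)))) n,
    Finset.sum_congr rfl fun a _ => hterm a, ← Finset.mul_sum]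
  have hn0 : q ^ (2 * n) ≠ 0 := pow_ne_zero _ hq
  have hi0 : q ^ (2 * (i : ℕ)) ≠ 0 := pow_ne_zero _ hq
  have hk0 : q ^ (2 * (k : ℕ)) ≠ 0 := pow_ne_zero _ hq
  have hun : u n = q * (x * w)⁻¹ := by rw [hxw]
  have hxw0 : x * w ≠ 0 := by rw [hxw]; exact hn0
  have hx0 := left_ne_zero_of_mul hxw0
  have hw0 := right_ne_zero_of_mul hxw0
  have hu0 : u 0 = q := by simp [hu]
  have hus : ∀ a, u (a + 1) = q⁻¹ * (q ^ (2 * a))⁻¹ := by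
    intro a
    simp only [hu, mul_add, pow_add]
    field_simp
  have hps : ∀ a : ℕ, q ^ (2 * (a + 1)) = q ^ (2 * a) * q ^ 2 := fun a => by
    rw [mul_add, pow_add]
  rcases lt_trichotomy (k : ℕ) i with h | h | h
  · rw [sum_range_telescope_two_steps u x w h.le i.2, hu0, hun, hus, hus, hps, hps]
    have hne : i ≠ k := fun e => by simp [e] at h
    rw [if_neg h.not_gt, if_neg hne, if_neg hne, if_pos h]
    generalize q ^ (2 * (k : ℕ)) = L at *
    generalize q ^ (2 * (i : ℕ)) = I at *
    field_simp
    ring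
  · obtain rfl : k = i := Fin.ext h
    rw [sum_range_telescope_two_steps u x w le_rfl k.2, hu0, hun, hus, hps]
    generalize q ^ (2 * (k : ℕ)) = I at *
    simp only [lt_irrefl, if_true, if_false]
    field_simp
    ring
  · simp only [mul_comm (ite ((k : ℕ) < _) x 1) (ite ((i : ℕ) < _) w 1)]
    rw [sum_range_telescope_two_steps u w x h.le k.2, hu0, hun, hus, hus, hps, hps]
    have hne : i ≠ k := fun e => by simp [e] at h
    rw [if_neg h.not_gt, if_neg hne, if_neg hne, if_pos h]
    generalize q ^ (2 * (k : ℕ)) = L at *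
    generalize q ^ (2 * (i : ℕ)) = I at *
    field_simp
    ring

theorem sum_sum_diag_add_swap {K ι : Type*} [Field K] [Fintype ι] [DecidableEq ι]
    (e g h : ι → ι → K) (c : ι → K) (d : K) (i j k l : ι) :
    ∑ b, ∑ a, ((if k = a then if b = l then e k b else 0 else 0) +
        (if a = b then if l = k then g k b else 0 else 0)) *
      (c a * ((if j = b then if a = i then e j a else 0 else 0) +
        (if b = a then if i = j then h j a else 0 else 0)) * d) =
      (if k = i ∧ j = l then e k l * (c k * e j i * d) else 0) +
      (if k = l ∧ j = i then e k k * (c k * h i k * d) + g k i * (c i * e i i * d) +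
        ∑ a, g k a * (c a * h i a * d) else 0) := by
  have hterm : ∀ a b, ((if k = a then if b = l then e k b else 0 else 0) +
        (if a = b then if l = k then g k b else 0 else 0)) *
      (c a * ((if j = b then if a = i then e j a else 0 else 0) +
        (if b = a then if i = j then h j a else 0 else 0)) * d) =
      (if k = a then if j = b then if k = i ∧ j = l then e k l * (c k * e j i * d) else 0
        else 0 else 0) +
      (if k = a then if k = b then if k = l ∧ j = i then e k k * (c k * h i k * d) else 0
        else 0 else 0) +
      (if i = a then if i = b then if k = l ∧ j = i then g k i * (c i * e i i * d) else 0
        else 0 else 0) +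
      (if b = a then if k = l ∧ j = i then g k a * (c a * h i a * d) else 0 else 0) := by
    intro a b
    grind
  simp only [hterm, Finset.sum_add_distrib, Finset.sum_ite_irrel, Finset.sum_const_zero,
    Finset.sum_ite_eq, Finset.mem_univ, if_true]
  split_ifs <;> ring

theorem crossing_identity {K : Type*} [Field K] {n : ℕ} {q x w : K} (hq : q ≠ 0)
    (hx : 1 - x ≠ 0) (hw : 1 - w ≠ 0) (hxw : x * w = q ^ (2 * n)) (i j k l : Fin n) :
    ∑ b : Fin n, ∑ a : Fin n, Rmat n q x (k, b) (a, l) *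
        ((q ^ (2 * ((a : ℕ) + 1)))⁻¹ * Rmat n q w (j, a) (b, i) * q ^ (2 * ((i : ℕ) + 1))) =
      if j = l ∧ i = k then 1 else 0 := by
  simp only [Rmat_apply hx, Rmat_apply hw]
  rw [sum_sum_diag_add_swap (fun a b : Fin n => if a = b then q⁻¹ else 1)
    (fun a b : Fin n => (q - q⁻¹) / (1 - x) * (if (a : ℕ) < b then x else 1))
    (fun a b : Fin n => (q - q⁻¹) / (1 - w) * (if (a : ℕ) < b then w else 1))
    (fun a : Fin n => (q ^ (2 * ((a : ℕ) + 1)))⁻¹)]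
  have key := crossing_scalar_identity hq hx hw hxw i k
  have hcancel : ∀ c : K, (q ^ (2 * ((i : ℕ) + 1)))⁻¹ * c * q ^ (2 * ((i : ℕ) + 1)) = c := by
    intro c
    field_simp
  simp only [if_true, hcancel] at key ⊢
  by_cases hkl : k = l ∧ j = i
  · rw [if_pos hkl]
    obtain ⟨rfl, rfl⟩ := hkl
    by_cases hjk : j = k
    · subst hjk
      simp only [hcancel, and_self, if_true] at key ⊢
      linear_combination key
    · simp only [hjk, if_false, and_false, zero_add] at key ⊢
      linear_combination key
  · rw [if_neg hkl, add_zero]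
    by_cases h : k = i ∧ j = l
    · obtain ⟨rfl, rfl⟩ := h
      have hne : k ≠ j := fun e => hkl ⟨e, e.symm⟩
      simp [hne, hne.symm, hq]
    · rw [if_neg h, if_neg (fun h' => h ⟨h'.2.symm, h'.1⟩)]

theorem algebraMap_ne_of_eval_ne {σ : Type*} (f g : MvPolynomial σ ℚ) (e : σ → ℚ)
    (h : eval e f ≠ eval e g) :
    algebraMap (MvPolynomial σ ℚ) (FractionRing (MvPolynomial σ ℚ)) f ≠
      algebraMap (MvPolynomial σ ℚ) (FractionRing (MvPolynomial σ ℚ)) g :=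
  fun hfg => h (congrArg _ (IsFractionRing.injective _ _ hfg))

/-- `A₁₃ · (R(z·p²)ᵀ)₃₄ · (D₁⁻¹·R̃⁺₁₂(z)·D₁) · A₂₄ = A₁₃ · A₂₄`. -/
theorem elem_identity_A (n : ℕ) (hn : 1 ≤ n) :
    pl13 n (Amat n K4) *
        pl34 n (Matrix.transpose (Rmat n q4 (z4 * (q4 ^ n * qbar4) ^ 2))) *
        pl12 n ((D1 n q4)⁻¹ * Rtilde n q4 qbar4 z4 * D1 n q4) *
        pl24 n (Amat n K4)
      = pl13 n (Amat n K4) * pl24 n (Amat n K4) := by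
  have hq : q4 ≠ 0 := by simp [q4]
  have hqb : qbar4 ≠ 0 := by simp [qbar4]
  have hz : z4 ≠ 0 := by simp [z4]
  have hx : 1 - z4 * (q4 ^ n * qbar4) ^ 2 ≠ 0 := by
    have := algebraMap_ne_of_eval_ne (1 : MvPolynomial (Fin 3) ℚ)
      (X 2 * (X 0 ^ n * X 1) ^ 2) 0 (by simp)
    simpa [q4, qbar4, z4, sub_eq_zero] using this
  have hw : 1 - (z4 * qbar4 ^ 2)⁻¹ ≠ 0 := by
    have := algebraMap_ne_of_eval_ne (1 : MvPolynomial (Fin 3) ℚ)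
      (X 2 * X 1 ^ 2) 0 (by simp)
    rw [sub_ne_zero, ne_comm, Ne, inv_eq_one, eq_comm]
    simpa [qbar4, z4] using this
  have hxw : z4 * (q4 ^ n * qbar4) ^ 2 * (z4 * qbar4 ^ 2)⁻¹ = q4 ^ (2 * n) := by
    rw [pow_mul']
    field_simp
  ext ⟨p₁, p₂, p₃, p₄⟩ ⟨r₁, r₂, r₃, r₄⟩
  rw [mul_pl24_Amat_apply, mul_pl24_Amat_apply]
  simp only [Matrix.mul_assoc (pl13 n (Amat n K4)), pl13_Amat_mul_apply, pl34_mul_pl12_apply,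
    Matrix.transpose_apply, D1_conj_apply hq, Rtilde_apply]
  have key := crossing_identity hq hx hw hxw r₁ p₂ r₃ p₄
  by_cases h1 : p₁ = p₃
  · by_cases h2 : r₂ = r₄
    · simp only [h1, h2, if_true, key]
      simp [pl13, Amat, ite_and, eq_comm]
    · simp [h2]
  · simp [h1, pl13, Amat]

end
end

section
/- Let K = ℚ(q, z), V = K^n, and A = Σ_{1≤i,j≤n} E_{ij}⊗E_{ij} ∈ End(V⊗V). Then in End(V^{⊗4}), with tensor factors labeled 1,2,3,4: (R(1/z)ᵀ)₄₃ · R₁₂(z) · A₁₃ · A₂₄ = f(z) · A₁₃ · A₂₄, where (R(1/z)ᵀ)₄₃ is the full transpose of R(1/z) placed with its first factor in position 4 and second factor in position 3, A₁₃ (resp. A₂₄) denotes A acting in factors 1 and 3 (resp. 2 and 4), and f(z) = (1 − z q²)(1 − z q⁻²)/(1 − z)². -/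
/-!
STATEMENT 5: In End(V^{⊗4}) with tensor factors labeled 1,2,3,4:
`(R(1/z)ᵀ)₄₃ · R₁₂(z) · A₁₃ · A₂₄ = f(z) · A₁₃ · A₂₄`,
where K = ℚ(q, z), V = K^n, A = Σ_{i,j} E_ij ⊗ E_ij, and
`f(z) = (1 − z q²)(1 − z q⁻²)/(1 − z)²`.
-/

open MvPolynomial

noncomputable section

/-- The field ℚ(q, z). -/
abbrev K5 : Type := FractionRing (MvPolynomial (Fin 2) ℚ)

noncomputable def q5 : K5 := algebraMap (MvPolynomial (Fin 2) ℚ) K5 (X 0)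
noncomputable def z5 : K5 := algebraMap (MvPolynomial (Fin 2) ℚ) K5 (X 1)

/-- An operator on V⊗V acting with its first factor in position 4 and its
second factor in position 3 of V^{⊗4}. -/
def pl43 (n : ℕ) {K : Type*} [Field K]
    (Xm : Matrix (Fin n × Fin n) (Fin n × Fin n) K) : Matrix (I4 n) (I4 n) K :=
  Matrix.of fun p r => Xm (p.2.2.2, p.2.2.1) (r.2.2.2, r.2.2.1) *
    (if p.1 = r.1 ∧ p.2.1 = r.2.1 then 1 else 0)

/-- The vector `Σ e_i ⊗ e_j ⊗ e_i ⊗ e_j`. -/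
def pairVec (n : ℕ) (K : Type*) [Field K] : I4 n → K :=
  fun p => if p.1 = p.2.2.1 ∧ p.2.1 = p.2.2.2 then 1 else 0

theorem pl13_mul_pl24_Amat (n : ℕ) (K : Type*) [Field K] :
    pl13 n (Amat n K) * pl24 n (Amat n K) =
      Matrix.vecMulVec (pairVec n K) (pairVec n K) := by
  ext ⟨a, b, c, d⟩ ⟨e, f, g, h⟩
  rw [Matrix.mul_apply, Finset.sum_eq_single (e, b, e, d)]
  · simp only [pl13, pl24, Amat, pairVec, Matrix.of_apply, Matrix.vecMulVec_apply]
    grind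
  · rintro ⟨x, y, u, v⟩ - h_ne
    simp only [pl13, pl24, Amat, Matrix.of_apply]
    grind
  · simp

theorem pl12_mulVec_pairVec (n : ℕ) {K : Type*} [Field K]
    (M : Matrix (Fin n × Fin n) (Fin n × Fin n) K) (p : I4 n) :
    (pl12 n M).mulVec (pairVec n K) p = M (p.1, p.2.1) p.2.2 := by
  obtain ⟨a, b, c, d⟩ := p
  rw [Matrix.mulVec, dotProduct, Finset.sum_eq_single (c, d, c, d)]
  · simp [pl12, pairVec]
  · rintro ⟨x, y, u, v⟩ - h_ne
    simp only [pl12, pairVec, Matrix.of_apply]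
    grind
  · simp

theorem pl43_mulVec (n : ℕ) {K : Type*} [Field K]
    (M : Matrix (Fin n × Fin n) (Fin n × Fin n) K) (w : I4 n → K) (p : I4 n) :
    (pl43 n M).mulVec w p =
      ∑ r : Fin n × Fin n, M (p.2.2.2, p.2.2.1) r.swap * w (p.1, p.2.1, r) := by
  obtain ⟨a, b, c, d⟩ := p
  rw [Matrix.mulVec, dotProduct, Fintype.sum_prod_type, Finset.sum_eq_single a,
    Fintype.sum_prod_type, Finset.sum_eq_single b]
  · simp [pl43, Prod.swap]
  · rintro y - h
    simp [pl43, h.symm]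
  · simp
  · rintro x - h
    simp [pl43, h.symm]
  · simp

theorem sum_Rmat_mul (n : ℕ) {K : Type*} [Field K] (q x : K) (p : Fin n × Fin n)
    (g : Fin n × Fin n → K) :
    ∑ r, g r * Rmat n q x p r =
      if p.1 = p.2 then g p * ((q - x * q⁻¹) / (1 - x))
      else g p + g p.swap * ((q - q⁻¹) * (if p.1 < p.2 then x else 1) / (1 - x)) := by
  obtain ⟨a, b⟩ := p
  have h_swap : ∀ r : Fin n × Fin n,
      (a ≠ b ∧ r.1 = b ∧ r.2 = a) ↔ (a ≠ b ∧ (b, a) = r) := by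
    rintro ⟨c, d⟩
    grind
  by_cases h : a = b
  · simp [Rmat, h]
  · simp only [Rmat, Matrix.of_apply, h_swap]
    simp [h, mul_add, Finset.sum_add_distrib]

/-- Unitarity: `R₁₂(x) R₂₁(1/x) = f(x)`, written in coordinates. -/
theorem Rmat_unitarity (n : ℕ) {K : Type*} [Field K] {q x : K} (hq : q ≠ 0) (hx : x ≠ 0)
    (hx1 : 1 - x ≠ 0) (p s : Fin n × Fin n) :
    ∑ r, Rmat n q x⁻¹ r.swap s.swap * Rmat n q x p r =
      (1 - x * q ^ 2) * (1 - x * (q ^ 2)⁻¹) / (1 - x) ^ 2 * (if p = s then 1 else 0) := by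
  have h_inv : 1 - x⁻¹ = -(1 - x) / x := by field_simp; ring
  rw [sum_Rmat_mul n q x p fun r => Rmat n q x⁻¹ r.swap s.swap]
  obtain ⟨a, b⟩ := p
  obtain ⟨c, d⟩ := s
  simp only [Rmat, Matrix.of_apply, Prod.swap, Prod.mk.injEq, h_inv]
  rcases lt_trichotomy a b with h | rfl | h
  · by_cases h_id : a = c ∧ b = d
    · obtain ⟨rfl, rfl⟩ := h_id
      simp [-neg_sub, h, h.ne, h.ne']
      field_simp
      ring
    · by_cases h_sw : b = c ∧ a = d
      · obtain ⟨rfl, rfl⟩ := h_sw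
        simp [-neg_sub, h, h.ne, h.ne', h.not_gt]
        field_simp
        ring
      · grind
  · by_cases h_id : a = c ∧ a = d
    · obtain ⟨rfl, rfl⟩ := h_id
      simp [-neg_sub]
      field_simp
      ring
    · have h_comm : ¬(a = d ∧ a = c) := fun h => h_id h.symm
      simp [h_id, h_comm]
  · by_cases h_id : a = c ∧ b = d
    · obtain ⟨rfl, rfl⟩ := h_id
      simp [-neg_sub, h.ne, h.ne', h.not_gt]
      field_simp
      ring
    · by_cases h_sw : b = c ∧ a = d
      · obtain ⟨rfl, rfl⟩ := h_sw
        simp [-neg_sub, h, h.ne, h.ne', h.not_gt]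
        field_simp
        ring
      · grind

theorem q5_ne_zero : q5 ≠ 0 := by
  simp [q5]

theorem z5_ne_zero : z5 ≠ 0 := by
  simp [z5]

theorem one_sub_z5_ne_zero : 1 - z5 ≠ 0 := by
  rw [sub_ne_zero, z5, ← map_one (algebraMap (MvPolynomial (Fin 2) ℚ) K5)]
  intro h
  have h_eval := congrArg (MvPolynomial.eval 0) (IsFractionRing.injective _ K5 h)
  simp at h_eval

/-- `(R(1/z)ᵀ)₄₃ · R₁₂(z) · A₁₃ · A₂₄ = f(z) · A₁₃ · A₂₄`. -/
theorem elem_identity_f (n : ℕ) (hn : 1 ≤ n) :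
    pl43 n (Matrix.transpose (Rmat n q5 z5⁻¹)) * pl12 n (Rmat n q5 z5) *
        pl13 n (Amat n K5) * pl24 n (Amat n K5)
      = ((1 - z5 * q5 ^ 2) * (1 - z5 * (q5 ^ 2)⁻¹) / (1 - z5) ^ 2) •
          (pl13 n (Amat n K5) * pl24 n (Amat n K5)) := by
  rw [Matrix.mul_assoc, pl13_mul_pl24_Amat, Matrix.mul_vecMulVec, ← Matrix.smul_vecMulVec,
    ← Matrix.mulVec_mulVec]
  congr 1
  ext ⟨a, b, c, d⟩
  simp only [pl43_mulVec, pl12_mulVec_pairVec, Matrix.transpose_apply]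
  refine (Rmat_unitarity n q5_ne_zero z5_ne_zero one_sub_z5_ne_zero (a, b) (c, d)).trans ?_
  simp [pairVec]

end
end
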